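/- Let N ≥ 2 be an integer, h ∈ ℂ, and q ∈ ℂ nonzero and not a root of unity. Let A = (A_{ij})_{1≤i,j≤N−1} be the Cartan matrix of sl_N. Let V be a complex vector space, P : V × V → ℂ a bilinear map, and a_j[n] ∈ V for j = 1, …, N−1 and n ∈ ℤ∖{0}, satisfying P(a_i[n], a_j[m]) = (2h/(q − q^{−1}))·[A_{ij}·n]_q·δ_{n,−m} for all i,j and all nonzero n,m. For i = 1, …, N and n ∈ ℤ∖{0}, define λ_i[n] = −q^{Nn}(q − q^{−1})·Σ_{j=1}^{i−1} ([jn]_q/[Nn]_q)·a_j[n] + (q − q^{−1})·Σ_{j=i}^{N−1} ([(N−j)n]_q/[Nn]_q)·a_j[n]. Then for all nonzero n, m ∈ ℤ: P(λ_i[n], λ_i[m]) = 2h(q − q^{−1})·([(N−1)n]_q·[n]_q/[Nn]_q)·δ_{n,−m} for every i, and P(λ_i[n], λ_j[m]) = −2h(q − q^{−1})·([n]_q²/[Nn]_q)·q^{−Nn}·δ_{n,−m} whenever i < j. -/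

import Mathlib

/-- The q-integer `[n]_q = (qⁿ − q⁻ⁿ)/(q − q⁻¹)`. -/
noncomputable def qint (q : ℂ) (n : ℤ) : ℂ := (q ^ n - q ^ (-n)) / (q - q⁻¹)

open Finset

theorem qint_mul (q : ℂ) (k n : ℤ) :
    qint q (k * n) = ((q ^ n) ^ k - (q ^ n) ^ (-k)) / (q - q⁻¹) := by
  rw [qint, ← zpow_mul, ← zpow_mul, mul_comm n k, mul_neg, mul_comm n k]

theorem qint_neg (q : ℂ) (n : ℤ) : qint q (-n) = -qint q n := by
  rw [qint, qint, neg_neg, ← neg_div, neg_sub]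

theorem qint_zero (q : ℂ) : qint q 0 = 0 := by
  simp [qint]

/-- The coefficient of `a_k[n]` in `λ_i[n]`, up to the common factor `q - q⁻¹`. -/
noncomputable def lamCoeff (q : ℂ) (N i : ℕ) (n : ℤ) (k : ℕ) : ℂ :=
  if k < i then -(q ^ ((N : ℤ) * n) * (qint q ((k : ℤ) * n) / qint q ((N : ℤ) * n)))
  else qint q (((N : ℤ) - (k : ℤ)) * n) / qint q ((N : ℤ) * n)

theorem lamCoeff_zero (q : ℂ) (N : ℕ) {i : ℕ} (hi : 1 ≤ i) (n : ℤ) :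
    lamCoeff q N i n 0 = 0 := by
  rw [lamCoeff, if_pos (by omega)]
  simp [qint_zero]

theorem lamCoeff_self (q : ℂ) {N i : ℕ} (hi : i ≤ N) (n : ℤ) :
    lamCoeff q N i n N = 0 := by
  rw [lamCoeff, if_neg (by omega)]
  simp [qint_zero]

/-- The `q`-deformed Cartan matrix acts on sequences vanishing at `0` and `N` as a discrete
Laplacian. -/
theorem sum_mul_qint_cartan (q : ℂ) (n : ℤ) {N j : ℕ} (hj : 1 ≤ j) (hjN : j + 1 ≤ N)
    (f : ℕ → ℂ) (h0 : f 0 = 0) (hN : f N = 0) :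
    ∑ k ∈ Finset.Icc 1 (N - 1), f k * qint q ((if k = j then 2
      else if (k : ℤ) - (j : ℤ) = 1 ∨ (j : ℤ) - (k : ℤ) = 1 then -1 else 0) * n) =
    qint q (2 * n) * f j - qint q n * (f (j - 1) + f (j + 1)) := by
  have hterm : ∀ k ∈ Finset.Icc 1 (N - 1), f k * qint q ((if k = j then 2
      else if (k : ℤ) - (j : ℤ) = 1 ∨ (j : ℤ) - (k : ℤ) = 1 then -1 else 0) * n) =
      (if k = j then qint q (2 * n) * f j else 0) - (if k = j - 1 then qint q n * f (j - 1) else 0)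
        - (if k = j + 1 then qint q n * f (j + 1) else 0) := by
    intro k _
    rcases lt_trichotomy k j with hk | rfl | hk
    · by_cases hk' : k = j - 1
      · subst hk'
        rw [if_neg (by omega), if_pos (by omega), if_neg (by omega), if_pos rfl,
          if_neg (by omega), neg_one_mul, qint_neg]
        ring
      · rw [if_neg (by omega), if_neg (by omega), if_neg (by omega), if_neg hk',
          if_neg (by omega), zero_mul, qint_zero]
        ring
    · rw [if_pos rfl, if_pos rfl, if_neg (by omega), if_neg (by omega)]
      ring
    · by_cases hk' : k = j + 1
      · subst hk'
        rw [if_neg (by omega), if_pos (by omega), if_neg (by omega), if_neg (by omega),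
          if_pos rfl, neg_one_mul, qint_neg]
        ring
      · rw [if_neg (by omega), if_neg (by omega), if_neg (by omega), if_neg (by omega),
          if_neg hk', zero_mul, qint_zero]
        ring
  rw [Finset.sum_congr rfl hterm, Finset.sum_sub_distrib, Finset.sum_sub_distrib,
    Finset.sum_ite_eq', Finset.sum_ite_eq', Finset.sum_ite_eq',
    if_pos (Finset.mem_Icc.mpr (by omega))]
  have h1 : (if j - 1 ∈ Finset.Icc 1 (N - 1) then qint q n * f (j - 1) else 0)
      = qint q n * f (j - 1) := by
    split_ifs with hm
    · rfl
    · have : j - 1 = 0 := by rw [Finset.mem_Icc] at hm; omega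
      rw [this, h0, mul_zero]
  have h2 : (if j + 1 ∈ Finset.Icc 1 (N - 1) then qint q n * f (j + 1) else 0)
      = qint q n * f (j + 1) := by
    split_ifs with hm
    · rfl
    · have : j + 1 = N := by rw [Finset.mem_Icc] at hm; omega
      rw [this, hN, mul_zero]
  rw [h1, h2]
  ring

/-- The Laplacian of the coefficients of `λ_i[n]` is supported at `i - 1` and `i`. -/
theorem lamCoeff_laplacian {q : ℂ} (hq : q ≠ 0) (hq2 : q - q⁻¹ ≠ 0) {N i j : ℕ} (hj : 1 ≤ j)
    {n : ℤ} (hNn : qint q ((N : ℤ) * n) ≠ 0) :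
    qint q (2 * n) * lamCoeff q N i n j
      - qint q n * (lamCoeff q N i n (j - 1) + lamCoeff q N i n (j + 1)) =
    (if j = i then qint q n * (q ^ n) ^ ((i : ℤ) - 1) else 0)
      - (if j + 1 = i then qint q n * (q ^ n) ^ (i : ℤ) else 0) := by
  obtain ⟨l, rfl⟩ : ∃ l, j = l + 1 := ⟨j - 1, by omega⟩
  have hx : q ^ n ≠ 0 := zpow_ne_zero n hq
  have hn1 : qint q n = ((q ^ n) ^ (1 : ℤ) - (q ^ n) ^ (-1 : ℤ)) / (q - q⁻¹) := by
    rw [← qint_mul, one_mul]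
  have hqN : q ^ ((N : ℤ) * n) = (q ^ n) ^ N := by
    rw [← zpow_natCast, ← zpow_mul, mul_comm]
  rw [qint_mul] at hNn
  have hD : (q ^ n) ^ (N : ℤ) - (q ^ n) ^ (-(N : ℤ)) ≠ 0 := fun h0 => hNn (by rw [h0, zero_div])
  simp only [lamCoeff, hn1, qint_mul, hqN]
  generalize q ^ n = x at *
  have hN0 : x ^ N ≠ 0 := pow_ne_zero _ hx
  have hl0 : x ^ l ≠ 0 := pow_ne_zero _ hx
  have hD' : (x ^ N) ^ 2 - 1 ≠ 0 := by
    intro h0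
    apply hD
    rw [zpow_neg, zpow_natCast]
    field_simp
    linear_combination h0
  generalize q - q⁻¹ = s at *
  rcases lt_trichotomy (l + 1) i with hi | rfl | hi
  · by_cases hi' : l + 1 + 1 = i
    · subst hi'
      simp [zpow_add₀ hx, zpow_sub₀ hx, zpow_neg]
      generalize x ^ N = X at *
      field_simp
      ring
    · rw [if_pos hi, if_pos (by omega), if_pos (by omega), if_neg (by omega), if_neg hi']
      simp [zpow_add₀ hx, zpow_neg]
      generalize x ^ N = X at *
      field_simp
      ring
  · simp [zpow_add₀ hx, zpow_sub₀ hx, zpow_neg]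
    generalize x ^ N = X at *
    field_simp
    ring
  · rw [if_neg (by omega), if_neg (by omega), if_neg (by omega), if_neg (by omega),
      if_neg (by omega)]
    simp [zpow_add₀ hx, zpow_sub₀ hx, zpow_neg]
    generalize x ^ N = X at *
    field_simp
    ring

theorem lam_eq_sum {V : Type*} [AddCommGroup V] [Module ℂ V] (q : ℂ) {N i : ℕ}
    (hi : i ∈ Finset.Icc 1 N) (n : ℤ) (a : ℕ → ℤ → V) :
    -((q ^ ((N : ℤ) * n) * (q - q⁻¹)) •
          ∑ j ∈ Finset.Icc 1 (i - 1), (qint q ((j : ℤ) * n) / qint q ((N : ℤ) * n)) • a j n)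
        + (q - q⁻¹) •
          ∑ j ∈ Finset.Icc i (N - 1),
            (qint q (((N : ℤ) - (j : ℤ)) * n) / qint q ((N : ℤ) * n)) • a j n =
    (q - q⁻¹) • ∑ k ∈ Finset.Icc 1 (N - 1), lamCoeff q N i n k • a k n := by
  rw [Finset.mem_Icc] at hi
  have hlt : (Finset.Icc 1 (N - 1)).filter (· < i) = Finset.Icc 1 (i - 1) := by
    ext k; simp only [Finset.mem_filter, Finset.mem_Icc]; omega
  have hge : (Finset.Icc 1 (N - 1)).filter (¬ · < i) = Finset.Icc i (N - 1) := by
    ext k; simp only [Finset.mem_filter, Finset.mem_Icc]; omega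
  rw [← Finset.sum_filter_add_sum_filter_not (Finset.Icc 1 (N - 1)) (· < i), hlt, hge, smul_add,
    mul_comm, mul_smul, ← smul_neg, Finset.smul_sum (r := q ^ ((N : ℤ) * n)),
    ← Finset.sum_neg_distrib]
  congr 2
  · refine Finset.sum_congr rfl fun k hk => ?_
    rw [Finset.mem_Icc] at hk
    rw [lamCoeff, if_pos (by omega), neg_smul, mul_smul]
  · refine Finset.sum_congr rfl fun k hk => ?_
    rw [Finset.mem_Icc] at hk
    rw [lamCoeff, if_neg (by omega)]

/-- The Poisson bracket of `λ_i[n]` and `λ_j[m]` in terms of the coefficients of `λ_j[m]`. -/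
theorem lam_bracket {V : Type*} [AddCommGroup V] [Module ℂ V] {N : ℕ} (h : ℂ) {q : ℂ}
    (hq : q ≠ 0) (hq2 : q - q⁻¹ ≠ 0) (P : V →ₗ[ℂ] V →ₗ[ℂ] ℂ) (a : ℕ → ℤ → V)
    {n m : ℤ} (hNn : qint q ((N : ℤ) * n) ≠ 0)
    (hP : ∀ i ∈ Finset.Icc 1 (N - 1), ∀ j ∈ Finset.Icc 1 (N - 1),
      P (a i n) (a j m) = (2 * h / (q - q⁻¹)) *
        qint q ((if i = j then 2
          else if (i : ℤ) - (j : ℤ) = 1 ∨ (j : ℤ) - (i : ℤ) = 1 then -1 else 0) * n) *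
        (if m = -n then 1 else 0))
    {i j : ℕ} (hi : i ∈ Finset.Icc 1 N) (hj : j ∈ Finset.Icc 1 N) :
    P ((q - q⁻¹) • ∑ k ∈ Finset.Icc 1 (N - 1), lamCoeff q N i n k • a k n)
      ((q - q⁻¹) • ∑ k ∈ Finset.Icc 1 (N - 1), lamCoeff q N j m k • a k m) =
    2 * h * (q - q⁻¹) * qint q n * ((q ^ n) ^ ((i : ℤ) - 1) * lamCoeff q N j m i
      - (q ^ n) ^ (i : ℤ) * lamCoeff q N j m (i - 1)) * (if m = -n then 1 else 0) := by
  rw [Finset.mem_Icc] at hi hj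
  have hinner : ∀ l ∈ Finset.Icc 1 (N - 1),
      P (∑ k ∈ Finset.Icc 1 (N - 1), lamCoeff q N i n k • a k n) (a l m) =
      (2 * h / (q - q⁻¹)) * (if m = -n then 1 else 0) *
        ((if l = i then qint q n * (q ^ n) ^ ((i : ℤ) - 1) else 0)
          - (if l + 1 = i then qint q n * (q ^ n) ^ (i : ℤ) else 0)) := by
    intro l hl
    have hl' := Finset.mem_Icc.mp hl
    rw [← lamCoeff_laplacian hq hq2 hl'.1 hNn,
      ← sum_mul_qint_cartan q n hl'.1 (by omega) _ (lamCoeff_zero q N hi.1 n)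
        (lamCoeff_self q hi.2 n), map_sum, LinearMap.sum_apply, Finset.mul_sum]
    refine Finset.sum_congr rfl fun k hk => ?_
    rw [map_smul, LinearMap.smul_apply, hP k hk l hl, smul_eq_mul]
    ring
  have hi1 : ∀ l, l + 1 = i ↔ l = i - 1 := fun l => by omega
  have houter : ∑ l ∈ Finset.Icc 1 (N - 1), lamCoeff q N j m l *
      ((if l = i then qint q n * (q ^ n) ^ ((i : ℤ) - 1) else 0)
          - (if l + 1 = i then qint q n * (q ^ n) ^ (i : ℤ) else 0)) =
      lamCoeff q N j m i * (qint q n * (q ^ n) ^ ((i : ℤ) - 1))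
        - lamCoeff q N j m (i - 1) * (qint q n * (q ^ n) ^ (i : ℤ)) := by
    simp only [mul_sub, mul_ite, mul_zero, Finset.sum_sub_distrib, hi1, Finset.sum_ite_eq',
      Finset.mem_Icc]
    congr 1
    · split_ifs with hm
      · rfl
      · have : i = N := by omega
        rw [this, lamCoeff_self q hj.2, zero_mul]
    · split_ifs with hm
      · rfl
      · have : i - 1 = 0 := by omega
        rw [this, lamCoeff_zero q N hj.1, zero_mul]
  rw [map_smul P, LinearMap.smul_apply, map_smul, map_sum]
  have hsum : ∑ l ∈ Finset.Icc 1 (N - 1),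
      P (∑ k ∈ Finset.Icc 1 (N - 1), lamCoeff q N i n k • a k n) (lamCoeff q N j m l • a l m) =
      (2 * h / (q - q⁻¹)) * (if m = -n then 1 else 0) *
      (lamCoeff q N j m i * (qint q n * (q ^ n) ^ ((i : ℤ) - 1))
        - lamCoeff q N j m (i - 1) * (qint q n * (q ^ n) ^ (i : ℤ))) := by
    rw [← houter, Finset.mul_sum]
    refine Finset.sum_congr rfl fun l hl => ?_
    rw [map_smul, hinner l hl, smul_eq_mul]
    ring
  rw [hsum, smul_eq_mul, smul_eq_mul]
  generalize (if m = -n then (1 : ℂ) else 0) = d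
  field_simp

theorem qint_ne_zero {q : ℂ} (hq : q ≠ 0) (hroot : ∀ r : ℕ, 0 < r → q ^ r ≠ 1)
    {n : ℤ} (hn : n ≠ 0) : qint q n ≠ 0 := by
  have key : ∀ k : ℤ, k ≠ 0 → q ^ k - q ^ (-k) ≠ 0 := by
    intro k hk h0
    refine hroot (2 * k).natAbs (by omega) ?_
    have h1 : q ^ (2 * k) = 1 := by
      rw [two_mul, zpow_add₀ hq]
      nth_rewrite 1 [sub_eq_zero.mp h0]
      rw [← zpow_add₀ hq, neg_add_cancel, zpow_zero]
    rw [← zpow_natCast]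
    rcases Int.natAbs_eq (2 * k) with h2 | h2
    · rw [← h2, h1]
    · rw [h2, zpow_neg, inv_eq_one] at h1
      exact h1
  exact div_ne_zero (key n hn) (by simpa using key 1 one_ne_zero)

/-- Poisson brackets of the generators `λ_i[n]` of the Heisenberg–Poisson algebra
`H_h(sl_N)` in terms of the generators `a_j[n]` with
`P(a_i[n], a_j[m]) = (2h/(q−q⁻¹))[A_{ij}n]_q δ_{n,−m}`:
`P(λ_i[n], λ_i[m]) = 2h(q−q⁻¹)([(N−1)n]_q[n]_q/[Nn]_q)δ_{n,−m}` and, for `i < j`,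
`P(λ_i[n], λ_j[m]) = −2h(q−q⁻¹)([n]_q²/[Nn]_q)q^{−Nn}δ_{n,−m}`. -/
theorem lambda_poisson_brackets (N : ℕ) (hN : 2 ≤ N) (h : ℂ) (q : ℂ) (hq : q ≠ 0)
    (hroot : ∀ r : ℕ, 0 < r → q ^ r ≠ 1)
    (V : Type*) [AddCommGroup V] [Module ℂ V]
    (P : V →ₗ[ℂ] V →ₗ[ℂ] ℂ)
    (a : ℕ → ℤ → V)
    (hP : ∀ i ∈ Finset.Icc 1 (N - 1), ∀ j ∈ Finset.Icc 1 (N - 1), ∀ n m : ℤ,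
      n ≠ 0 → m ≠ 0 →
      P (a i n) (a j m) = (2 * h / (q - q⁻¹)) *
        qint q ((if i = j then 2
          else if (i : ℤ) - (j : ℤ) = 1 ∨ (j : ℤ) - (i : ℤ) = 1 then -1 else 0) * n) *
        (if m = -n then 1 else 0))
    (lam : ℕ → ℤ → V)
    (hlam : ∀ i ∈ Finset.Icc 1 N, ∀ n : ℤ, n ≠ 0 →
      lam i n = -((q ^ ((N : ℤ) * n) * (q - q⁻¹)) •
          ∑ j ∈ Finset.Icc 1 (i - 1), (qint q ((j : ℤ) * n) / qint q ((N : ℤ) * n)) • a j n)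
        + (q - q⁻¹) •
          ∑ j ∈ Finset.Icc i (N - 1),
            (qint q (((N : ℤ) - (j : ℤ)) * n) / qint q ((N : ℤ) * n)) • a j n) :
    (∀ i ∈ Finset.Icc 1 N, ∀ n m : ℤ, n ≠ 0 → m ≠ 0 →
      P (lam i n) (lam i m) = 2 * h * (q - q⁻¹) *
        (qint q (((N : ℤ) - 1) * n) * qint q n / qint q ((N : ℤ) * n)) *
        (if m = -n then 1 else 0)) ∧
    (∀ i ∈ Finset.Icc 1 N, ∀ j ∈ Finset.Icc 1 N, i < j → ∀ n m : ℤ, n ≠ 0 → m ≠ 0 →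
      P (lam i n) (lam j m) = -(2 * h * (q - q⁻¹)) *
        ((qint q n) ^ 2 / qint q ((N : ℤ) * n)) * q ^ (-(N : ℤ) * n) *
        (if m = -n then 1 else 0)) := by
  have hq2 : q - q⁻¹ ≠ 0 := fun h0 => qint_ne_zero hq hroot one_ne_zero (by simp [qint, h0])
  have hNn : ∀ n : ℤ, n ≠ 0 → qint q ((N : ℤ) * n) ≠ 0 := fun n hn =>
    qint_ne_zero hq hroot (mul_ne_zero (by omega) hn)
  have hbr : ∀ i ∈ Finset.Icc 1 N, ∀ j ∈ Finset.Icc 1 N, ∀ n m : ℤ, n ≠ 0 → m ≠ 0 →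
      P (lam i n) (lam j m) = 2 * h * (q - q⁻¹) * qint q n *
        ((q ^ n) ^ ((i : ℤ) - 1) * lamCoeff q N j m i
          - (q ^ n) ^ (i : ℤ) * lamCoeff q N j m (i - 1)) * (if m = -n then 1 else 0) := by
    intro i hi j hj n m hn hm
    rw [hlam i hi n hn, hlam j hj m hm, lam_eq_sum q hi, lam_eq_sum q hj]
    exact lam_bracket h hq hq2 P a (hNn n hn) (fun k hk l hl => hP k hk l hl n m hn hm) hi hj
  have hcast : ∀ i ∈ Finset.Icc 1 N, ((i - 1 : ℕ) : ℤ) = (i : ℤ) - 1 := fun i hi => by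
    rw [Finset.mem_Icc] at hi; omega
  have hx : ∀ n : ℤ, q ^ n ≠ 0 := fun n => zpow_ne_zero n hq
  have hqN : ∀ n : ℤ, q ^ (-((N : ℤ) * n)) = ((q ^ n) ^ N)⁻¹ := fun n => by
    rw [← zpow_natCast, ← zpow_mul, mul_comm n, zpow_neg]
  constructor
  · intro i hi n m hn hm
    rw [hbr i hi i hi n m hn hm]
    by_cases hmn : m = -n
    · subst hmn
      have hi' := Finset.mem_Icc.mp hi
      have hD := hNn n hn
      suffices hs : (q ^ n) ^ ((i : ℤ) - 1) * lamCoeff q N i (-n) i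
          - (q ^ n) ^ (i : ℤ) * lamCoeff q N i (-n) (i - 1) =
          qint q (((N : ℤ) - 1) * n) / qint q ((N : ℤ) * n) by
        rw [hs]; ring
      rw [lamCoeff, lamCoeff, if_neg (by omega), if_pos (by omega), hcast i hi]
      simp only [mul_neg, qint_neg, neg_div_neg_eq, hqN]
      field_simp
      simp only [qint_mul]
      have := hx n
      generalize q ^ n = x at *
      simp [zpow_sub₀ this]
      field_simp
      ring
    · rw [if_neg hmn, mul_zero, mul_zero]
  · intro i hi j hj hij n m hn hm
    rw [hbr i hi j hj n m hn hm]
    by_cases hmn : m = -n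
    · subst hmn
      have hi' := Finset.mem_Icc.mp hi
      have hD := hNn n hn
      suffices hs : (q ^ n) ^ ((i : ℤ) - 1) * lamCoeff q N j (-n) i
          - (q ^ n) ^ (i : ℤ) * lamCoeff q N j (-n) (i - 1) =
          -(qint q (1 * n) / qint q ((N : ℤ) * n) * q ^ (-(N : ℤ) * n)) by
        rw [hs, one_mul]; ring
      rw [lamCoeff, lamCoeff, if_pos (by omega), if_pos (by omega), hcast i hi]
      simp only [neg_mul, mul_neg, qint_neg, neg_div_neg_eq, hqN]
      have := hx n
      field_simp
      simp only [qint_mul]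
      generalize q ^ n = x at *
      simp [zpow_sub₀ this, zpow_neg]
      field_simp
      ring
    · rw [if_neg hmn, mul_zero, mul_zero]
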